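/- arXiv:1509.09206 — 12 statements merged into one kernel-verified Lean document; each statement's English description precedes it below -/
import Mathlib

section
/- Let a ≠ 0 and b ≠ 0. Every equilibrium p = (p₁,p₂,p₃) of the RF system other than the origin satisfies p₃ ≠ 0, p₁ ≠ 0, and p₁·p₂ = −b. -/
/-- The Rabinovich–Fabrikant vector field with parameters `a`, `b`. -/
def rf (a b : ℝ) (x : ℝ × ℝ × ℝ) : ℝ × ℝ × ℝ :=
  (x.2.1 * (x.2.2 - 1 + x.1 ^ 2) + a * x.1,
   x.1 * (3 * x.2.2 + 1 - x.1 ^ 2) + a * x.2.1,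
   -2 * x.2.2 * (b + x.1 * x.2.1))

/-- For `a ≠ 0`, `b ≠ 0`, every equilibrium of the RF system other than the origin
satisfies `p₃ ≠ 0`, `p₁ ≠ 0`, and `p₁·p₂ = −b`. -/
theorem rf_nonzero_equilibrium (a b : ℝ) (ha : a ≠ 0) (hb : b ≠ 0) (p : ℝ × ℝ × ℝ)
    (heq : rf a b p = (0, 0, 0)) (hp : p ≠ (0, 0, 0)) :
    p.2.2 ≠ 0 ∧ p.1 ≠ 0 ∧ p.1 * p.2.1 = -b := by
  obtain ⟨x, y, z⟩ := p
  simp only [rf, Prod.mk.injEq] at heq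
  obtain ⟨h₁, h₂, h₃⟩ := heq
  have hz : z ≠ 0 := by
    rintro rfl
    have h : x ^ 2 + y ^ 2 = 0 :=
      (mul_eq_zero.mp (by linear_combination x * h₁ + y * h₂ :
        a * (x ^ 2 + y ^ 2) = 0)).resolve_left ha
    have hx : x = 0 := by nlinarith [sq_nonneg x, sq_nonneg y]
    have hy : y = 0 := by nlinarith [sq_nonneg x, sq_nonneg y]
    exact hp (by rw [hx, hy])
  have hxy : x * y = -b := by
    have h : b + x * y = 0 := (mul_eq_zero.mp h₃).resolve_left (by simpa using hz)
    linear_combination h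
  refine ⟨hz, ?_, hxy⟩
  rintro rfl
  exact hb (by linear_combination hxy)
end

section
/- Let a ≠ 0 and b ≠ 0. Every equilibrium p = (p₁,p₂,p₃) of the RF system other than the origin satisfies the quartic equation (4b − 3a)·p₁⁴ − 4b·p₁² + a·b² = 0 together with p₂ = −b/p₁ and p₃ = 1 + (a/b − 1)·p₁². -/
/-- For `a ≠ 0`, `b ≠ 0`, every equilibrium of the RF system other than the origin
satisfies the quartic `(4b − 3a)p₁⁴ − 4b p₁² + a b² = 0`, together with
`p₂ = −b/p₁` and `p₃ = 1 + (a/b − 1) p₁²`. -/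
theorem rf_nonzero_equilibrium_quartic (a b : ℝ) (ha : a ≠ 0) (hb : b ≠ 0)
    (p : ℝ × ℝ × ℝ) (heq : rf a b p = (0, 0, 0)) (hp : p ≠ (0, 0, 0)) :
    (4 * b - 3 * a) * p.1 ^ 4 - 4 * b * p.1 ^ 2 + a * b ^ 2 = 0
    ∧ p.2.1 = -b / p.1
    ∧ p.2.2 = 1 + (a / b - 1) * p.1 ^ 2 := by
  obtain ⟨x, y, z⟩ := p
  simp only [rf, Prod.mk.injEq] at heq
  obtain ⟨h₁, h₂, h₃⟩ := heq
  have hxy : b + x * y = 0 := by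
    by_contra hne
    have hz : z = 0 := by simpa [hne] using h₃
    subst hz
    have hsum : x ^ 2 + y ^ 2 = 0 :=
      mul_left_cancel₀ ha (by linear_combination x * h₁ + y * h₂)
    have hx : x = 0 := by nlinarith [sq_nonneg x, sq_nonneg y]
    have hy : y = 0 := by nlinarith [sq_nonneg x, sq_nonneg y]
    exact hp (by rw [hx, hy])
  have hx : x ≠ 0 := by
    rintro rfl
    exact hb (by simpa using hxy)
  have hz : b * z = b + (a - b) * x ^ 2 := by
    linear_combination (z - 1 + x ^ 2) * hxy - x * h₁
  refine ⟨?_, ?_, ?_⟩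
  · linear_combination 3 * x ^ 2 * hz + a * b * hxy - b * x * h₂
  · rw [eq_div_iff hx]
    linear_combination hxy
  · field_simp
    linear_combination hz
end

section
/- Let a ≠ 0 and b ≠ 0, and let r ∈ ℝ with r ≠ 0 satisfy (4b − 3a)·r⁴ − 4b·r² + a·b² = 0. Then the point (r, −b/r, 1 + (a/b − 1)·r²) is an equilibrium of the RF system. -/
/-- For `a ≠ 0`, `b ≠ 0`, any nonzero real root `r` of the quartic
`(4b − 3a)r⁴ − 4b r² + a b² = 0` gives rise to the equilibrium
`(r, −b/r, 1 + (a/b − 1)r²)` of the RF system. -/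
theorem rf_quartic_root_equilibrium (a b : ℝ) (ha : a ≠ 0) (hb : b ≠ 0) (r : ℝ)
    (hr : r ≠ 0) (hroot : (4 * b - 3 * a) * r ^ 4 - 4 * b * r ^ 2 + a * b ^ 2 = 0) :
    rf a b (r, -b / r, 1 + (a / b - 1) * r ^ 2) = (0, 0, 0) := by
  simp only [rf, Prod.mk.injEq]
  refine ⟨?_, ?_, ?_⟩
  · field_simp
    ring
  · field_simp
    linear_combination -hroot
  · field_simp
    ring
end

section
/- Let a > 0, b > 0, and 4b ≠ 3a. Then the set of equilibria of the RF system, i.e. {x ∈ ℝ³ : f(x) = 0}, is finite and has at most five elements. -/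
open Polynomial in
/-- The quartic satisfied by the first coordinate of every nonzero equilibrium. -/
noncomputable def rfQuartic (a b : ℝ) : ℝ[X] :=
  C (3 * a - 4 * b) * X ^ 4 + C (4 * b) * X ^ 2 - C (a * b ^ 2)

theorem rfQuartic_natDegree_le (a b : ℝ) : (rfQuartic a b).natDegree ≤ 4 := by
  unfold rfQuartic
  compute_degree

theorem rfQuartic_ne_zero {a b : ℝ} (hab : 4 * b ≠ 3 * a) : rfQuartic a b ≠ 0 := by
  intro h
  have hc : (rfQuartic a b).coeff 4 = 3 * a - 4 * b := by
    unfold rfQuartic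
    compute_degree!
  rw [h, Polynomial.coeff_zero] at hc
  exact hab (by linarith)

/-- The only equilibrium in the plane `z = 0` is the origin. -/
theorem eq_zero_of_rf_planar {a x y : ℝ} (ha : 0 < a)
    (h₁ : y * (x ^ 2 - 1) + a * x = 0) (h₂ : x * (1 - x ^ 2) + a * y = 0) :
    x = 0 ∧ y = 0 := by
  have h : a * (x ^ 2 + y ^ 2) = 0 := by linear_combination x * h₁ + y * h₂
  have hxy : x ^ 2 + y ^ 2 = 0 := (mul_eq_zero.mp h).resolve_left ha.ne'
  constructor <;> nlinarith [sq_nonneg x, sq_nonneg y]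

/-- Every equilibrium is the origin or is determined by a root of `rfQuartic a b`. -/
theorem rf_equilibria_subset {a b : ℝ} (ha : 0 < a) (hb : 0 < b) (hab : 4 * b ≠ 3 * a) :
    {x : ℝ × ℝ × ℝ | rf a b x = (0, 0, 0)} ⊆
      ↑(insert (0, 0, 0) ((rfQuartic a b).roots.toFinset.image
        fun x : ℝ => (x, -b / x, 1 + x ^ 2 * (a - b) / b))) := by
  rintro ⟨x, y, z⟩ h
  simp only [Set.mem_ofPred_eq, rf, Prod.mk.injEq] at h
  obtain ⟨h₁, h₂, h₃⟩ := h
  rw [Finset.mem_coe, Finset.mem_insert]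
  by_cases hz : z = 0
  · subst hz
    obtain ⟨rfl, rfl⟩ := eq_zero_of_rf_planar (x := x) (y := y) ha
      (by linear_combination h₁) (by linear_combination h₂)
    exact Or.inl rfl
  · right
    have hxy : b + x * y = 0 := (mul_eq_zero.mp h₃).resolve_left (by simpa using hz)
    have hx : x ≠ 0 := by
      rintro rfl
      linarith
    have hzb : b * z = b + x ^ 2 * (a - b) := by
      linear_combination (z - 1 + x ^ 2) * hxy - x * h₁
    rw [Finset.mem_image]
    refine ⟨x, ?_, ?_⟩
    · rw [Multiset.mem_toFinset, Polynomial.mem_roots (rfQuartic_ne_zero hab)]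
      simp only [Polynomial.IsRoot.def, rfQuartic, Polynomial.eval_sub, Polynomial.eval_add,
        Polynomial.eval_mul, Polynomial.eval_C, Polynomial.eval_pow, Polynomial.eval_X]
      linear_combination b * x * h₂ - 3 * x ^ 2 * hzb - a * b * hxy
    · have hy : -b / x = y := by
        rw [div_eq_iff hx]
        linear_combination -hxy
      have hz' : 1 + x ^ 2 * (a - b) / b = z := by
        field_simp
        linear_combination -hzb
      rw [hy, hz']

/-- For `a > 0`, `b > 0` with `4b ≠ 3a`, the set of equilibria of the RF system is
finite, with at most five elements. -/
theorem rf_equilibria_finite (a b : ℝ) (ha : 0 < a) (hb : 0 < b) (hab : 4 * b ≠ 3 * a) :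
    {x : ℝ × ℝ × ℝ | rf a b x = (0, 0, 0)}.Finite
    ∧ {x : ℝ × ℝ × ℝ | rf a b x = (0, 0, 0)}.ncard ≤ 5 := by
  have hsub := rf_equilibria_subset ha hb hab
  refine ⟨(Finset.finite_toSet _).subset hsub, ?_⟩
  calc
    _ ≤ _ := Set.ncard_le_ncard hsub (Finset.finite_toSet _)
    _ = _ := Set.ncard_coe_finset _
    _ ≤ _ := Finset.card_insert_le _ _
    _ ≤ 4 + 1 := by
      gcongr
      exact Finset.card_image_le.trans <| (Multiset.toFinset_card_le _).trans <|
        (Polynomial.card_roots' _).trans (rfQuartic_natDegree_le a b)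
end

section
/- Let a, b ∈ ℝ with b > 0, 4b − 3a > 0, and 3a² − 4ab + 4 ≥ 0, and set R₁ = √(3a² − 4ab + 4) and R₂ = 4ab² − 7a²b + 3a³ + 2a. Then the point X₁* = (−√(b(R₁ + 2)/(4b − 3a)), √(b(4b − 3a)/(R₁ + 2)), (aR₁ + R₂)/((4b − 3a)R₁ + 8b − 6a)) is an equilibrium of the RF system, and so is its reflection X₂* = (√(b(R₁ + 2)/(4b − 3a)), −√(b(4b − 3a)/(R₁ + 2)), (aR₁ + R₂)/((4b − 3a)R₁ + 8b − 6a)). -/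
/-- With `d = 4b − 3a` and `R² = 3a² − 4ab + 4`, a point `(p, q, z)` such that `p² = b(R+2)/d` and
`q = −pd/(R+2)`, with `z` as below, is an equilibrium. -/
lemma rf_eq_zero {a b d R p q z : ℝ} (hd : d = 4 * b - 3 * a) (hd₀ : d ≠ 0) (hs : R + 2 ≠ 0)
    (hR : R ^ 2 = 3 * a ^ 2 - 4 * a * b + 4)
    (hp : p ^ 2 = b * (R + 2) / d)
    (hq : q = -(p * (d / (R + 2))))
    (hz : z = 1 - (b - a) * (R + 2) / d) :
    rf a b (p, q, z) = (0, 0, 0) := by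
  have hpq : p * q = -b := by
    rw [hq, show p * -(p * (d / (R + 2))) =
      -(p ^ 2 * (d / (R + 2))) by ring, hp]
    field_simp
  have h₁ : d / (R + 2) * (z - 1 + p ^ 2) = a := by
    rw [hz, hp]
    field_simp
    ring
  have h₂ : 3 * z + 1 - p ^ 2 = a * (d / (R + 2)) := by
    rw [hz, hp]
    field_simp
    linear_combination ((R + 2) ^ 2 - d * a) * hd - d * hR
  simp only [rf, Prod.mk.injEq]
  refine ⟨?_, ?_, ?_⟩
  · rw [hq]
    linear_combination -p * h₁
  · rw [hq]
    linear_combination p * h₂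
  · linear_combination -2 * z * hpq

/-- For `b > 0`, `4b − 3a > 0`, `3a² − 4ab + 4 ≥ 0`, with
`R₁ = √(3a² − 4ab + 4)` and `R₂ = 4ab² − 7a²b + 3a³ + 2a`, the points
`X₁* = (−√(b(R₁+2)/(4b−3a)), √(b(4b−3a)/(R₁+2)), (aR₁+R₂)/((4b−3a)R₁+8b−6a))` and its
reflection `X₂*` are equilibria of the RF system. -/
theorem rf_equilibria_X12 (a b : ℝ) (hb : 0 < b) (hab : 0 < 4 * b - 3 * a)
    (hR : 0 ≤ 3 * a ^ 2 - 4 * a * b + 4) :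
    let R₁ : ℝ := Real.sqrt (3 * a ^ 2 - 4 * a * b + 4)
    let R₂ : ℝ := 4 * a * b ^ 2 - 7 * a ^ 2 * b + 3 * a ^ 3 + 2 * a
    rf a b (-Real.sqrt (b * (R₁ + 2) / (4 * b - 3 * a)),
            Real.sqrt (b * (4 * b - 3 * a) / (R₁ + 2)),
            (a * R₁ + R₂) / ((4 * b - 3 * a) * R₁ + 8 * b - 6 * a)) = (0, 0, 0)
    ∧ rf a b (Real.sqrt (b * (R₁ + 2) / (4 * b - 3 * a)),
              -Real.sqrt (b * (4 * b - 3 * a) / (R₁ + 2)),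
              (a * R₁ + R₂) / ((4 * b - 3 * a) * R₁ + 8 * b - 6 * a)) = (0, 0, 0) := by
  intro R₁ R₂
  have hR₁ : R₁ ^ 2 = 3 * a ^ 2 - 4 * a * b + 4 := Real.sq_sqrt hR
  have hs : 0 < R₁ + 2 := by linarith [Real.sqrt_nonneg (3 * a ^ 2 - 4 * a * b + 4)]
  have hp := Real.sq_sqrt (show 0 ≤ b * (R₁ + 2) / (4 * b - 3 * a) by positivity)
  have hq : Real.sqrt (b * (4 * b - 3 * a) / (R₁ + 2)) =
      Real.sqrt (b * (R₁ + 2) / (4 * b - 3 * a)) * ((4 * b - 3 * a) / (R₁ + 2)) := by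
    rw [Real.sqrt_eq_iff_mul_self_eq (by positivity) (by positivity), ← sq, mul_pow, hp]
    field_simp
  have hz : (a * R₁ + R₂) / ((4 * b - 3 * a) * R₁ + 8 * b - 6 * a) =
      1 - (b - a) * (R₁ + 2) / (4 * b - 3 * a) := by
    rw [show (4 * b - 3 * a) * R₁ + 8 * b - 6 * a = (4 * b - 3 * a) * (R₁ + 2) by ring]
    simp only [R₂]
    generalize hd : 4 * b - 3 * a = d at hab ⊢
    field_simp
    linear_combination (b - a) * hR₁ + (R₁ + 2) * hd
  constructor
  · exact rf_eq_zero rfl hab.ne' hs.ne' hR₁ (by rw [neg_sq, hp]) (by rw [hq]; ring) hz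
  · exact rf_eq_zero rfl hab.ne' hs.ne' hR₁ hp (by rw [hq]) hz
end

section
/- Let a, b ∈ ℝ with b > 0, 3a² − 4ab + 4 ≥ 0, and set R₁ = √(3a² − 4ab + 4) and R₂ = 4ab² − 7a²b + 3a³ + 2a. Assume moreover that b(R₁ − 2)/(3a − 4b) > 0 and (4b − 3a)/(2 − R₁) > 0. Then the point X₃* = (−√(b(R₁ − 2)/(3a − 4b)), √(b(4b − 3a)/(2 − R₁)), (aR₁ − R₂)/((4b − 3a)R₁ − 8b + 6a)) is an equilibrium of the RF system, and so is its reflection X₄* = (√(b(R₁ − 2)/(3a − 4b)), −√(b(4b − 3a)/(2 − R₁)), (aR₁ − R₂)/((4b − 3a)R₁ − 8b + 6a)). -/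
/-- For `b > 0`, `3a² − 4ab + 4 ≥ 0`, with `R₁ = √(3a² − 4ab + 4)` and
`R₂ = 4ab² − 7a²b + 3a³ + 2a`, assuming `b(R₁−2)/(3a−4b) > 0` and
`(4b−3a)/(2−R₁) > 0`, the points
`X₃* = (−√(b(R₁−2)/(3a−4b)), √(b(4b−3a)/(2−R₁)), (aR₁−R₂)/((4b−3a)R₁−8b+6a))` and its
reflection `X₄*` are equilibria of the RF system. -/
theorem rf_equilibria_X34 (a b : ℝ) (hb : 0 < b)
    (hR : 0 ≤ 3 * a ^ 2 - 4 * a * b + 4)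
    (h₁ : 0 < b * (Real.sqrt (3 * a ^ 2 - 4 * a * b + 4) - 2) / (3 * a - 4 * b))
    (h₂ : 0 < (4 * b - 3 * a) / (2 - Real.sqrt (3 * a ^ 2 - 4 * a * b + 4))) :
    let R₁ : ℝ := Real.sqrt (3 * a ^ 2 - 4 * a * b + 4)
    let R₂ : ℝ := 4 * a * b ^ 2 - 7 * a ^ 2 * b + 3 * a ^ 3 + 2 * a
    rf a b (-Real.sqrt (b * (R₁ - 2) / (3 * a - 4 * b)),
            Real.sqrt (b * (4 * b - 3 * a) / (2 - R₁)),
            (a * R₁ - R₂) / ((4 * b - 3 * a) * R₁ - 8 * b + 6 * a)) = (0, 0, 0)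
    ∧ rf a b (Real.sqrt (b * (R₁ - 2) / (3 * a - 4 * b)),
              -Real.sqrt (b * (4 * b - 3 * a) / (2 - R₁)),
              (a * R₁ - R₂) / ((4 * b - 3 * a) * R₁ - 8 * b + 6 * a)) = (0, 0, 0) := by
  intro R₁ R₂
  have hRsq : R₁ ^ 2 = 3 * a ^ 2 - 4 * a * b + 4 := Real.sq_sqrt hR
  change 0 < b * (R₁ - 2) / (3 * a - 4 * b) at h₁
  change 0 < (4 * b - 3 * a) / (2 - R₁) at h₂
  have hE : 2 - R₁ ≠ 0 := by
    intro h
    simp [h] at h₂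
  have hD : 4 * b - 3 * a ≠ 0 := by
    intro h
    simp [h] at h₂
  set p := Real.sqrt (b * (R₁ - 2) / (3 * a - 4 * b))
  have hp2 : p ^ 2 = b * (R₁ - 2) / (3 * a - 4 * b) := Real.sq_sqrt h₁.le
  have hp2' : p ^ 2 = b * ((2 - R₁) / (4 * b - 3 * a)) := by
    rw [hp2, ← neg_sub (2 : ℝ) R₁, ← neg_sub (4 * b) (3 * a), mul_neg, neg_div_neg_eq, mul_div_assoc]
  have hts : (4 * b - 3 * a) / (2 - R₁) * ((2 - R₁) / (4 * b - 3 * a)) = 1 := by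
    field_simp
  have hat : a * ((4 * b - 3 * a) / (2 - R₁)) = 2 + R₁ := by
    field_simp
    linear_combination hRsq
  have hDs : (4 * b - 3 * a) * ((2 - R₁) / (4 * b - 3 * a)) = 2 - R₁ := by
    field_simp
  have hq : Real.sqrt (b * (4 * b - 3 * a) / (2 - R₁)) =
      p * ((4 * b - 3 * a) / (2 - R₁)) := by
    rw [Real.sqrt_eq_iff_mul_self_eq_of_pos (mul_pos (Real.sqrt_pos.2 h₁) h₂),
      mul_div_assoc b (4 * b - 3 * a)]
    linear_combination ((4 * b - 3 * a) / (2 - R₁)) ^ 2 * hp2' +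
      b * ((4 * b - 3 * a) / (2 - R₁)) * hts
  have hz : (a * R₁ - R₂) / ((4 * b - 3 * a) * R₁ - 8 * b + 6 * a) =
      1 + (a - b) * ((2 - R₁) / (4 * b - 3 * a)) := by
    rw [show (4 * b - 3 * a) * R₁ - 8 * b + 6 * a = -((4 * b - 3 * a) * (2 - R₁)) by ring,
      div_eq_iff (neg_ne_zero.2 (mul_ne_zero hD hE))]
    simp only [R₂]
    linear_combination (a - b) * hRsq + (a - b) * (2 - R₁) * hDs
  rw [hq, hz]
  generalize (4 * b - 3 * a) / (2 - R₁) = t at *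
  generalize (2 - R₁) / (4 * b - 3 * a) = s at *
  have hx : t * (1 + (a - b) * s - 1 + p ^ 2) = a := by
    linear_combination t * hp2' + a * hts
  have hy : 3 * (1 + (a - b) * s) + 1 - p ^ 2 = a * t := by
    linear_combination -hp2' - hat - hDs
  have hpt : p ^ 2 * t = b := by
    linear_combination t * hp2' + b * hts
  simp only [rf, Prod.mk.injEq, neg_sq]
  refine ⟨⟨?_, ?_, ?_⟩, ?_, ?_, ?_⟩
  · linear_combination p * hx
  · linear_combination -p * hy
  · linear_combination 2 * (1 + (a - b) * s) * hpt
  · linear_combination -p * hx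
  · linear_combination p * hy
  · linear_combination 2 * (1 + (a - b) * s) * hpt
end

section
/- Let a ∈ ℝ and let (x₁, x₂) : ℝ → ℝ² be a differentiable solution of the reduced planar system x₁' = x₂(−1 + x₁²) + a·x₁, x₂' = x₁(1 − x₁²) + a·x₂. Then for all t, t₀ ∈ ℝ, x₁(t)² + x₂(t)² = e^{2a(t − t₀)}·(x₁(t₀)² + x₂(t₀)²). -/
/-- For a solution of the reduced planar system
`x₁' = x₂(−1 + x₁²) + a x₁`, `x₂' = x₁(1 − x₁²) + a x₂` on `ℝ`, one has
`x₁(t)² + x₂(t)² = e^{2a(t − t₀)} (x₁(t₀)² + x₂(t₀)²)` for all `t, t₀`. -/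
theorem rf_reduced_radius_exp (a : ℝ) (x₁ x₂ : ℝ → ℝ)
    (h₁ : ∀ t : ℝ, HasDerivAt x₁ (x₂ t * (-1 + x₁ t ^ 2) + a * x₁ t) t)
    (h₂ : ∀ t : ℝ, HasDerivAt x₂ (x₁ t * (1 - x₁ t ^ 2) + a * x₂ t) t) :
    ∀ t t₀ : ℝ,
      x₁ t ^ 2 + x₂ t ^ 2 = Real.exp (2 * a * (t - t₀)) * (x₁ t₀ ^ 2 + x₂ t₀ ^ 2) := by
  intro t t₀
  have hderiv : ∀ s : ℝ, HasDerivAt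
      (fun s => Real.exp (-(2 * a * (s - t₀))) * (x₁ s ^ 2 + x₂ s ^ 2)) 0 s := by
    intro s
    have hexp := ((((hasDerivAt_id s).sub_const t₀).const_mul (2 * a)).fun_neg).exp
    have hr := ((h₁ s).fun_pow 2).fun_add ((h₂ s).fun_pow 2)
    refine (hexp.fun_mul hr).congr_deriv ?_
    simp only [id]
    push_cast
    ring
  have hconst := is_const_of_deriv_eq_zero (fun s => (hderiv s).differentiableAt)
    (fun s => (hderiv s).deriv) t t₀
  simp only [sub_self, mul_zero, neg_zero, Real.exp_zero, one_mul] at hconst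
  rw [← hconst, ← mul_assoc, ← Real.exp_add, add_neg_cancel, Real.exp_zero, one_mul]
end

section
/- Let a > 0 and let (x₁, x₂) : ℝ → ℝ² be a differentiable solution of the reduced planar system x₁' = x₂(−1 + x₁²) + a·x₁, x₂' = x₁(1 − x₁²) + a·x₂ with (x₁(0), x₂(0)) ≠ (0,0). Then x₁(t)² + x₂(t)² tends to +∞ as t → +∞ and (x₁(t), x₂(t)) tends to (0,0) as t → −∞. In particular, the origin attracts every solution of the reduced system in backward time (for a > 0 the origin is globally asymptotically stable for the time-reversed reduced system). -/
open Filter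

/-- A solution of `y' = c y` on `ℝ` is the exponential `y 0 * exp (c t)`. -/
theorem eq_mul_exp_of_hasDerivAt_mul_self {c : ℝ} {y : ℝ → ℝ}
    (h : ∀ t, HasDerivAt y (c * y t) t) (t : ℝ) : y t = y 0 * Real.exp (c * t) := by
  have hg : ∀ s, HasDerivAt (fun s => y s * Real.exp (-(c * s))) 0 s := fun s => by
    have he : HasDerivAt (fun s => -(c * s)) (-c) s := by
      exact (((hasDerivAt_id s).const_mul c).neg).congr_deriv (by rw [mul_one])
    exact ((h s).mul he.exp).congr_deriv (by ring)
  have hconst := is_const_of_deriv_eq_zero (fun s => (hg s).differentiableAt)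
    (fun s => (hg s).deriv) t 0
  simp only [mul_zero, neg_zero, Real.exp_zero, mul_one] at hconst
  rw [← hconst, mul_assoc, ← Real.exp_add, neg_add_cancel, Real.exp_zero, mul_one]

/-- For `a > 0`, every nontrivial solution of the reduced planar system
`x₁' = x₂(−1 + x₁²) + a x₁`, `x₂' = x₁(1 − x₁²) + a x₂` on `ℝ` satisfies
`x₁(t)² + x₂(t)² → +∞` as `t → +∞` and `(x₁(t), x₂(t)) → (0,0)` as `t → −∞`. -/
theorem rf_reduced_origin_backward_attractor (a : ℝ) (ha : 0 < a) (x₁ x₂ : ℝ → ℝ)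
    (h₁ : ∀ t : ℝ, HasDerivAt x₁ (x₂ t * (-1 + x₁ t ^ 2) + a * x₁ t) t)
    (h₂ : ∀ t : ℝ, HasDerivAt x₂ (x₁ t * (1 - x₁ t ^ 2) + a * x₂ t) t)
    (h0 : ((x₁ 0, x₂ 0) : ℝ × ℝ) ≠ (0, 0)) :
    Tendsto (fun t : ℝ => x₁ t ^ 2 + x₂ t ^ 2) atTop atTop
    ∧ Tendsto (fun t : ℝ => ((x₁ t, x₂ t) : ℝ × ℝ)) atBot (nhds (0, 0)) := by
  have hV : ∀ t, x₁ t ^ 2 + x₂ t ^ 2 = (x₁ 0 ^ 2 + x₂ 0 ^ 2) * Real.exp (2 * a * t) :=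
    eq_mul_exp_of_hasDerivAt_mul_self (y := fun t => x₁ t ^ 2 + x₂ t ^ 2) fun t =>
      (((h₁ t).pow 2).add ((h₂ t).pow 2)).congr_deriv (by push_cast; ring)
  have ha2 : 0 < 2 * a := by positivity
  have hV0 : 0 < x₁ 0 ^ 2 + x₂ 0 ^ 2 := by
    by_contra! h
    have e₁ : x₁ 0 = 0 := by nlinarith [sq_nonneg (x₁ 0), sq_nonneg (x₂ 0)]
    have e₂ : x₂ 0 = 0 := by nlinarith [sq_nonneg (x₁ 0), sq_nonneg (x₂ 0)]
    exact h0 (by rw [e₁, e₂])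
  have hbot : Tendsto (fun t => x₁ t ^ 2 + x₂ t ^ 2) atBot (nhds 0) := by
    rw [funext hV]
    simpa using (Real.tendsto_exp_atBot.comp
      (tendsto_id.const_mul_atBot ha2)).const_mul (x₁ 0 ^ 2 + x₂ 0 ^ 2)
  have hsqrt : Tendsto (fun t => √(x₁ t ^ 2 + x₂ t ^ 2)) atBot (nhds 0) := by
    simpa using hbot.sqrt
  refine ⟨?_, Tendsto.prodMk_nhds ?_ ?_⟩
  · rw [funext hV]
    exact (Real.tendsto_exp_atTop.comp (tendsto_id.const_mul_atTop ha2)).const_mul_atTop hV0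
  · exact squeeze_zero_norm
      (fun t => Real.abs_le_sqrt (le_add_of_nonneg_right (sq_nonneg (x₂ t)))) hsqrt
  · exact squeeze_zero_norm
      (fun t => Real.abs_le_sqrt (le_add_of_nonneg_left (sq_nonneg (x₁ t)))) hsqrt
end

section
/- Let a, b ∈ ℝ and let x : I → ℝ³ be a solution of the RF system on an interval I containing t₀ with x₃(t₀) = 0. Then x₃(t) = 0 for all t ∈ I; that is, the plane {x₃ = 0} is invariant under the RF flow. -/
/-- A solution of the scalar linear equation `z' = g z` with continuous coefficient `g` that
vanishes at the left end of a compact interval vanishes at the right end. -/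
theorem eq_zero_of_hasDerivAt_mul_of_le {z g : ℝ → ℝ} {p q : ℝ} (hpq : p ≤ q)
    (hz : ∀ t ∈ Set.Icc p q, HasDerivAt z (g t * z t) t)
    (hg : ContinuousOn g (Set.Icc p q)) (hp : z p = 0) : z q = 0 := by
  obtain ⟨K, hK⟩ := isCompact_Icc.exists_bound_of_continuousOn hg
  refine eq_zero_of_abs_deriv_le_mul_abs_self_of_eq_zero_right (K := K)
    (fun t ht => (hz t ht).continuousAt.continuousWithinAt)
    (fun t ht => (hz t (Set.Ico_subset_Icc_self ht)).hasDerivWithinAt) hp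
    (fun t ht => ?_) q (Set.right_mem_Icc.2 hpq)
  rw [norm_mul]
  exact mul_le_mul_of_nonneg_right (hK t (Set.Ico_subset_Icc_self ht)) (norm_nonneg _)

/-- A solution of the scalar linear equation `z' = g z` with continuous coefficient `g` on an
order-connected set vanishes identically if it vanishes at one point. -/
theorem eq_zero_of_hasDerivAt_mul {z g : ℝ → ℝ} {I : Set ℝ} (hI : I.OrdConnected)
    (hz : ∀ t ∈ I, HasDerivAt z (g t * z t) t) (hg : ContinuousOn g I)
    {t₀ : ℝ} (ht₀ : t₀ ∈ I) (h0 : z t₀ = 0) : ∀ t ∈ I, z t = 0 := by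
  intro t ht
  rcases le_total t₀ t with h | h
  · have hsub := hI.out ht₀ ht
    exact eq_zero_of_hasDerivAt_mul_of_le h (fun s hs => hz s (hsub hs)) (hg.mono hsub) h0
  · have hmaps : Set.MapsTo (fun s : ℝ => -s) (Set.Icc (-t₀) (-t)) I := fun s hs =>
      hI.out ht ht₀ ⟨by linarith [hs.2], by linarith [hs.1]⟩
    have key := eq_zero_of_hasDerivAt_mul_of_le (z := fun s => z (-s)) (g := fun s => -g (-s))
      (neg_le_neg h)
      (fun s hs => by
        have hcomp := (hz (-s) (hmaps hs)).scomp s (hasDerivAt_neg s)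
        simpa [Function.comp_def] using hcomp)
      (hg.comp continuous_neg.continuousOn hmaps).neg (by simpa using h0)
    simpa using key


/-- If a solution of the RF system on an interval `I` has `x₃(t₀) = 0` for some
`t₀ ∈ I`, then `x₃ ≡ 0` on `I`: the plane `{x₃ = 0}` is invariant under the RF flow. -/
theorem rf_plane_invariant (a b : ℝ) (I : Set ℝ) (hI : I.OrdConnected)
    (x : ℝ → ℝ × ℝ × ℝ) (hx : ∀ t ∈ I, HasDerivAt x (rf a b (x t)) t)
    (t₀ : ℝ) (ht₀ : t₀ ∈ I) (h0 : (x t₀).2.2 = 0) :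
    ∀ t ∈ I, (x t).2.2 = 0 := by
  have hcont : ContinuousOn x I := fun t ht => (hx t ht).continuousAt.continuousWithinAt
  refine eq_zero_of_hasDerivAt_mul (z := fun t => (x t).2.2)
    (g := fun t => -2 * (b + (x t).1 * (x t).2.1)) hI (fun t ht => ?_) (by fun_prop) ht₀ h0
  have hz := (hx t ht).hasFDerivAt.snd.snd.hasDerivAt
  simpa [rf, mul_right_comm] using hz
end

section
/- Let a, b ∈ ℝ and let x : I → ℝ³ be a solution of the RF system on an interval I containing t₀ with x₁(t₀) = x₂(t₀) = 0. Then x₁(t) = x₂(t) = 0 for all t ∈ I, and consequently x₃(t) = x₃(t₀)·e^{−2b(t − t₀)} for all t ∈ I; that is, the x₃-axis is invariant under the RF flow and the dynamics on it is x₃' = −2b·x₃. -/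
/-- A two-sided Grönwall uniqueness statement: a function which vanishes at `t₀` and whose
derivative is bounded by `K * ‖f‖` on the interval between `t₀` and `t` vanishes at `t`. -/
theorem eq_zero_of_norm_deriv_le_mul_norm_self_uIcc {E : Type*} [NormedAddCommGroup E]
    [NormedSpace ℝ E] {f f' : ℝ → E} {K t₀ t : ℝ}
    (hf : ∀ s ∈ Set.uIcc t₀ t, HasDerivAt f (f' s) s) (h₀ : f t₀ = 0)
    (bound : ∀ s ∈ Set.uIcc t₀ t, ‖f' s‖ ≤ K * ‖f s‖) : f t = 0 := by
  have hmem : ∀ r ∈ Set.Icc (0 : ℝ) 1, t₀ + r * (t - t₀) ∈ Set.uIcc t₀ t := fun r hr ↦ by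
    rw [← segment_eq_uIcc, segment_eq_image']
    exact ⟨r, hr, by simp⟩
  have hderiv : ∀ r ∈ Set.Icc (0 : ℝ) 1, HasDerivAt (fun r ↦ f (t₀ + r * (t - t₀)))
      ((t - t₀) • f' (t₀ + r * (t - t₀))) r := fun r hr ↦ by
    have hpath : HasDerivAt (fun r : ℝ ↦ t₀ + r * (t - t₀)) (t - t₀) r := by
      simpa using ((hasDerivAt_id r).mul_const (t - t₀)).const_add t₀
    exact (hf _ (hmem r hr)).scomp r hpath
  have h := eq_zero_of_abs_deriv_le_mul_abs_self_of_eq_zero_right (K := |t - t₀| * K)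
    (fun r hr ↦ (hderiv r hr).continuousAt.continuousWithinAt)
    (fun r hr ↦ (hderiv r (Set.Ico_subset_Icc_self hr)).hasDerivWithinAt)
    (by simpa using h₀)
    (fun r hr ↦ by
      rw [norm_smul, Real.norm_eq_abs, mul_assoc]
      exact mul_le_mul_of_nonneg_left (bound _ (hmem r (Set.Ico_subset_Icc_self hr)))
        (abs_nonneg _))
    1 (by simp)
  simpa using h

/-- If a solution of the RF system on an interval `I` has `x₁(t₀) = x₂(t₀) = 0` for some
`t₀ ∈ I`, then `x₁ ≡ x₂ ≡ 0` on `I` and `x₃(t) = x₃(t₀) e^{−2b(t − t₀)}`: the `x₃`-axis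
is invariant under the RF flow and the dynamics on it is `x₃' = −2b x₃`. -/
theorem rf_axis_invariant (a b : ℝ) (I : Set ℝ) (hI : I.OrdConnected)
    (x : ℝ → ℝ × ℝ × ℝ) (hx : ∀ t ∈ I, HasDerivAt x (rf a b (x t)) t)
    (t₀ : ℝ) (ht₀ : t₀ ∈ I) (h1 : (x t₀).1 = 0) (h2 : (x t₀).2.1 = 0) :
    ∀ t ∈ I, (x t).1 = 0 ∧ (x t).2.1 = 0
      ∧ (x t).2.2 = (x t₀).2.2 * Real.exp (-2 * b * (t - t₀)) := by
  have hx₁ : ∀ t ∈ I, HasDerivAt (fun t ↦ (x t).1) (rf a b (x t)).1 t := fun t ht ↦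
    (ContinuousLinearMap.fst ℝ ℝ (ℝ × ℝ)).hasFDerivAt.comp_hasDerivAt t (hx t ht)
  have hx₂₃ : ∀ t ∈ I, HasDerivAt (fun t ↦ (x t).2) (rf a b (x t)).2 t := fun t ht ↦
    (ContinuousLinearMap.snd ℝ ℝ (ℝ × ℝ)).hasFDerivAt.comp_hasDerivAt t (hx t ht)
  have hx₂ : ∀ t ∈ I, HasDerivAt (fun t ↦ (x t).2.1) (rf a b (x t)).2.1 t := fun t ht ↦
    (ContinuousLinearMap.fst ℝ ℝ ℝ).hasFDerivAt.comp_hasDerivAt t (hx₂₃ t ht)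
  have hx₃ : ∀ t ∈ I, HasDerivAt (fun t ↦ (x t).2.2) (rf a b (x t)).2.2 t := fun t ht ↦
    (ContinuousLinearMap.snd ℝ ℝ ℝ).hasFDerivAt.comp_hasDerivAt t (hx₂₃ t ht)
  have haxis : ∀ t ∈ I, (x t).1 = 0 ∧ (x t).2.1 = 0 := by
    intro t ht
    have hsub : Set.uIcc t₀ t ⊆ I := hI.uIcc_subset ht₀ ht
    obtain ⟨C, hC⟩ := isCompact_uIcc.exists_bound_of_continuousOn
      (fun s hs ↦ (hx₃ s (hsub hs)).continuousAt.continuousWithinAt :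
        ContinuousOn (fun s ↦ (x s).2.2) (Set.uIcc t₀ t))
    have hV : (x t).1 ^ 2 + (x t).2.1 ^ 2 = 0 := by
      refine eq_zero_of_norm_deriv_le_mul_norm_self_uIcc (t₀ := t₀) (K := 4 * C + 2 * |a|)
        (f := fun s ↦ (x s).1 ^ 2 + (x s).2.1 ^ 2)
        (f' := fun s ↦ 8 * (x s).2.2 * ((x s).1 * (x s).2.1)
          + 2 * a * ((x s).1 ^ 2 + (x s).2.1 ^ 2))
        (fun s hs ↦ ?_) (by simp [h1, h2]) (fun s hs ↦ ?_)
      · refine (((hx₁ s (hsub hs)).fun_pow 2).fun_add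
          ((hx₂ s (hsub hs)).fun_pow 2)).congr_deriv ?_
        simp only [rf]
        push_cast
        ring
      · have hz : |(x s).2.2| ≤ C := hC s hs
        have hxy : 2 * |(x s).1 * (x s).2.1| ≤ (x s).1 ^ 2 + (x s).2.1 ^ 2 := by
          rw [abs_mul, ← sq_abs (x s).1, ← sq_abs (x s).2.1]
          linarith [two_mul_le_add_sq |(x s).1| |(x s).2.1|]
        have hnonneg : 0 ≤ (x s).1 ^ 2 + (x s).2.1 ^ 2 := by positivity
        rw [Real.norm_eq_abs, Real.norm_eq_abs, abs_of_nonneg hnonneg]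
        calc _ ≤ |8 * (x s).2.2 * ((x s).1 * (x s).2.1)|
              + |2 * a * ((x s).1 ^ 2 + (x s).2.1 ^ 2)| := abs_add_le _ _
          _ = 4 * (|(x s).2.2| * (2 * |(x s).1 * (x s).2.1|))
              + 2 * |a| * ((x s).1 ^ 2 + (x s).2.1 ^ 2) := by
            rw [abs_mul, abs_mul 8, abs_mul (2 * a), abs_mul 2, abs_of_nonneg hnonneg,
              abs_of_pos (by norm_num : (0 : ℝ) < 8), abs_of_pos (by norm_num : (0 : ℝ) < 2)]
            ring
          _ ≤ 4 * (C * ((x s).1 ^ 2 + (x s).2.1 ^ 2))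
              + 2 * |a| * ((x s).1 ^ 2 + (x s).2.1 ^ 2) := by
            have := mul_le_mul hz hxy (by positivity) ((abs_nonneg _).trans hz)
            linarith
          _ = _ := by ring
    constructor <;> nlinarith [sq_nonneg (x t).1, sq_nonneg (x t).2.1]
  intro t ht
  refine ⟨(haxis t ht).1, (haxis t ht).2, sub_eq_zero.mp ?_⟩
  have hsub : Set.uIcc t₀ t ⊆ I := hI.uIcc_subset ht₀ ht
  refine eq_zero_of_norm_deriv_le_mul_norm_self_uIcc (t₀ := t₀) (K := |-2 * b|)
    (f := fun s ↦ (x s).2.2 - (x t₀).2.2 * Real.exp (-2 * b * (s - t₀)))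
    (f' := fun s ↦ -2 * b * ((x s).2.2 - (x t₀).2.2 * Real.exp (-2 * b * (s - t₀))))
    (fun s hs ↦ ?_) (by simp) (fun s _ ↦ (norm_mul _ _).le)
  have hexp := ((((hasDerivAt_id' s).sub_const t₀).const_mul (-2 * b)).exp).const_mul (x t₀).2.2
  refine ((hx₃ s (hsub hs)).fun_sub hexp).congr_deriv ?_
  simp only [rf, (haxis s (hsub hs)).1]
  ring
end

section
/- Let a > 0, b ∈ ℝ, and let Γ : ℝ → ℝ³ be a solution of the RF system with Γ₃(t) = 0 for all t ∈ ℝ. If Γ(t) converges to some point p ∈ ℝ³ as t → +∞, then Γ(t) = (0,0,0) for all t. In particular, no orbit contained in the unstable plane {x₃ = 0} of the origin is a heteroclinic orbit connecting the origin to another equilibrium (part of the proof that X₀* = (0,0,0) admits no heteroclinic or homoclinic orbits). -/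
open Filter

/-- A function with derivative `c V`, `c > 0`, that converges as `t → +∞` vanishes identically. -/
theorem eq_zero_of_hasDerivAt_mul_of_tendsto {c l : ℝ} (hc : 0 < c) {V : ℝ → ℝ}
    (hV : ∀ t, HasDerivAt V (c * V t) t) (hl : Tendsto V atTop (nhds l)) (t : ℝ) :
    V t = 0 := by
  have hderiv : ∀ s, HasDerivAt (fun s => V s * Real.exp (-(c * s))) 0 s := by
    intro s
    have hexp : HasDerivAt (fun s : ℝ => Real.exp (-(c * s)))
        (Real.exp (-(c * s)) * (-(c * 1))) s :=
      (((hasDerivAt_id s).const_mul c).neg).exp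
    exact ((hV s).mul hexp).congr_deriv (by ring)
  have hconst : ∀ s, V s * Real.exp (-(c * s)) = V t * Real.exp (-(c * t)) := fun s =>
    is_const_of_deriv_eq_zero (fun r => (hderiv r).differentiableAt)
      (fun r => (hderiv r).deriv) s t
  have hdecay : Tendsto (fun s : ℝ => Real.exp (-(c * s))) atTop (nhds 0) :=
    Real.tendsto_exp_neg_atTop_nhds_zero.comp (tendsto_id.const_mul_atTop hc)
  have hlim := hl.mul hdecay
  simp only [hconst, mul_zero] at hlim
  have hzero := tendsto_nhds_unique tendsto_const_nhds hlim
  exact (mul_eq_zero.mp hzero).resolve_right (Real.exp_ne_zero _)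

/-- Along a solution in the plane `{x₃ = 0}`, the squared radius grows at rate `2a`. -/
theorem hasDerivAt_sq_add_sq_of_rf_plane {a b : ℝ} {Γ : ℝ → ℝ × ℝ × ℝ} {t : ℝ}
    (hΓ : HasDerivAt Γ (rf a b (Γ t)) t) (h3 : (Γ t).2.2 = 0) :
    HasDerivAt (fun s => (Γ s).1 ^ 2 + (Γ s).2.1 ^ 2)
      (2 * a * ((Γ t).1 ^ 2 + (Γ t).2.1 ^ 2)) t := by
  have h₁ : HasDerivAt (fun s => (Γ s).1) (rf a b (Γ t)).1 t := hΓ.fst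
  have h₂ : HasDerivAt (fun s => (Γ s).2.1) (rf a b (Γ t)).2.1 t := hΓ.snd.fst
  refine ((h₁.pow 2).add (h₂.pow 2)).congr_deriv ?_
  simp only [rf, h3]
  push_cast
  ring

/-- For `a > 0`, any solution of the RF system lying in the plane `{x₃ = 0}` that
converges as `t → +∞` must be the constant solution at the origin; hence no orbit in
the unstable plane of the origin is a heteroclinic orbit from the origin to another
equilibrium. -/
theorem rf_plane_no_forward_convergence (a b : ℝ) (ha : 0 < a) (Γ : ℝ → ℝ × ℝ × ℝ)
    (hΓ : ∀ t : ℝ, HasDerivAt Γ (rf a b (Γ t)) t)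
    (h3 : ∀ t : ℝ, (Γ t).2.2 = 0)
    (p : ℝ × ℝ × ℝ) (hp : Tendsto Γ atTop (nhds p)) :
    ∀ t : ℝ, Γ t = (0, 0, 0) := by
  intro t
  have hlim : Tendsto (fun s => (Γ s).1 ^ 2 + (Γ s).2.1 ^ 2) atTop
      (nhds (p.1 ^ 2 + p.2.1 ^ 2)) :=
    (hp.fst_nhds.pow 2).add (hp.snd_nhds.fst_nhds.pow 2)
  have hzero : (Γ t).1 ^ 2 + (Γ t).2.1 ^ 2 = 0 :=
    eq_zero_of_hasDerivAt_mul_of_tendsto (mul_pos two_pos ha)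
      (fun s => hasDerivAt_sq_add_sq_of_rf_plane (hΓ s) (h3 s)) hlim t
  have hx : (Γ t).1 = 0 := by nlinarith [sq_nonneg (Γ t).1, sq_nonneg (Γ t).2.1]
  have hy : (Γ t).2.1 = 0 := by nlinarith [sq_nonneg (Γ t).1, sq_nonneg (Γ t).2.1]
  exact Prod.ext hx (Prod.ext hy (h3 t))
end

section
/- Let b > 0, a ∈ ℝ, and let Γ : ℝ → ℝ³ be a solution of the RF system with Γ₁(t) = Γ₂(t) = 0 for all t ∈ ℝ. If Γ is bounded on (−∞, 0] (in particular, if Γ(t) converges as t → −∞), then Γ(t) = (0,0,0) for all t. In particular, no orbit contained in the stable line {x₁ = x₂ = 0} of the origin is a heteroclinic orbit connecting another equilibrium to the origin (part of the proof that X₀* = (0,0,0) admits no heteroclinic or homoclinic orbits). -/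
open Filter Topology in
/-- A solution of the linear equation with rate `-c < 0` that is bounded on
`(−∞, 0]` vanishes identically. -/
theorem eq_zero_of_hasDerivAt_neg_mul_of_bounded {c : ℝ} (hc : 0 < c) {z : ℝ → ℝ}
    (hz : ∀ t, HasDerivAt z (-c * z t) t) {M : ℝ} (hM : ∀ t ≤ 0, |z t| ≤ M) (t : ℝ) :
    z t = 0 := by
  have hderiv (s : ℝ) : HasDerivAt (fun s => z s * Real.exp (c * s)) 0 s := by
    refine ((hz s).mul ((hasDerivAt_id' s).const_mul c).exp).congr_deriv ?_
    ring
  have hconst (s : ℝ) : z s * Real.exp (c * s) = z t * Real.exp (c * t) :=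
    is_const_of_deriv_eq_zero (fun s => (hderiv s).differentiableAt)
      (fun s => (hderiv s).deriv) s t
  have hlim : Tendsto (fun s => M * Real.exp (c * s)) atBot (𝓝 0) := by
    simpa using (Real.tendsto_exp_atBot.comp (tendsto_id.const_mul_atBot hc)).const_mul M
  have hle : |z t * Real.exp (c * t)| ≤ 0 := by
    refine ge_of_tendsto hlim ?_
    filter_upwards [eventually_le_atBot 0] with s hs
    rw [← hconst s, abs_mul, Real.abs_exp]
    gcongr
    exact hM s hs
  simpa using abs_nonpos_iff.mp hle

/-- For `b > 0`, any solution of the RF system lying on the line `{x₁ = x₂ = 0}` that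
is bounded on `(−∞, 0]` must be the constant solution at the origin; hence no orbit in
the stable line of the origin is a heteroclinic orbit from another equilibrium to the
origin. -/
theorem rf_axis_no_backward_bounded (a b : ℝ) (hb : 0 < b) (Γ : ℝ → ℝ × ℝ × ℝ)
    (hΓ : ∀ t : ℝ, HasDerivAt Γ (rf a b (Γ t)) t)
    (h1 : ∀ t : ℝ, (Γ t).1 = 0) (h2 : ∀ t : ℝ, (Γ t).2.1 = 0)
    (hbdd : ∃ M : ℝ, ∀ t : ℝ, t ≤ 0 → ‖Γ t‖ ≤ M) :
    ∀ t : ℝ, Γ t = (0, 0, 0) := by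
  obtain ⟨M, hM⟩ := hbdd
  have hz (t : ℝ) : HasDerivAt (fun t => (Γ t).2.2) (-(2 * b) * (Γ t).2.2) t := by
    have hsnd : HasDerivAt (fun t => (Γ t).2.2) (rf a b (Γ t)).2.2 t :=
      ((ContinuousLinearMap.snd ℝ ℝ ℝ).comp
        (ContinuousLinearMap.snd ℝ ℝ (ℝ × ℝ))).hasFDerivAt.comp_hasDerivAt t (hΓ t)
    refine hsnd.congr_deriv ?_
    simp only [rf, h1, h2]
    ring
  have hbound (t : ℝ) (ht : t ≤ 0) : |(Γ t).2.2| ≤ M :=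
    (norm_snd_le (Γ t).2).trans ((norm_snd_le (Γ t)).trans (hM t ht))
  intro t
  exact Prod.ext (h1 t) (Prod.ext (h2 t)
    (eq_zero_of_hasDerivAt_neg_mul_of_bounded (by positivity) hz hbound t))
end
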